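/- arXiv:1111.0925 — 3 statements merged into one kernel-verified Lean document; each statement's English description precedes it below -/
import Mathlib

section
/- There exists an absolute constant C > 0 such that the following holds. Let a, b ∈ ℂ with |Re a| ≤ 1/4 and |Re b| ≤ 1/4, set c = a − b, and let t ∈ ℝ satisfy |t + Im a| > 10|c| and |t + Im b| > 10|c|. Then χ(1/2 + a + it) χ(1/2 − b − it) = exp( −c log(|t + Im b|/(2π)) + (a + it) Log(1 + c/(1/2 − a − it)) + c ) · (1 + E), where |E| ≤ C |c| / |t + Im a|. -/
open Complex Real

/-- The `χ` factor from the functional equation `ζ(s) = χ(s) ζ(1-s)`: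
`χ(s) = 2^s π^(s-1) sin(πs/2) Γ(1-s)`. -/
noncomputable def fnEqChi (s : ℂ) : ℂ :=
  2 ^ s * (Real.pi : ℂ) ^ (s - 1) * Complex.sin (Real.pi * s / 2) * Complex.Gamma (1 - s)

lemma cpa_gron (f g : ℝ → ℂ) (ε : ℝ) (h0 : f 0 = 1)
    (hd : ∀ u ∈ Set.Icc (0:ℝ) 1, HasDerivAt f (g u * f u) u)
    (hg : ∀ u ∈ Set.Icc (0:ℝ) 1, ‖g u‖ ≤ ε) : ‖f 1 - 1‖ ≤ Real.exp ε - 1 := by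
  have hε : 0 ≤ ε := (norm_nonneg _).trans (hg 0 (by simp))
  have key := norm_le_gronwallBound_of_norm_deriv_right_le (f := fun u => f u - 1)
    (f' := fun u => g u * f u) (δ := 0) (K := ε) (ε := ε) (a := 0) (b := 1)
    (fun u hu => ((hd u hu).sub_const 1).continuousAt.continuousWithinAt)
    (fun u hu => ((hd u (Set.Ico_subset_Icc_self hu)).sub_const 1).hasDerivWithinAt)
    (by simp [h0])
    (fun u hu => by
      have h1 := hg u (Set.Ico_subset_Icc_self hu)
      have h2 : ‖f u‖ ≤ ‖f u - 1‖ + 1 := by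
        have := norm_add_le (f u - 1) 1
        simpa using this
      rw [norm_mul]
      nlinarith [norm_nonneg (g u), norm_nonneg (f u - 1)])
    1 (by simp)
  rcases eq_or_lt_of_le hε with h | h
  · subst h
    simpa [gronwallBound_K0] using key
  · rw [gronwallBound_of_K_ne_0 h.ne'] at key
    simpa [h.ne'] using key

lemma cpa_logdiff (v d : ℂ) (m : ℝ) (hm : 0 < m)
    (hs : ∀ u ∈ Set.Icc (0:ℝ) 1, v + u * d ∈ Complex.slitPlane)
    (hn : ∀ u ∈ Set.Icc (0:ℝ) 1, m ≤ ‖v + u * d‖) :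
    ‖Complex.log (v + d) - Complex.log v‖ ≤ ‖d‖ / m := by
  have := norm_image_sub_le_of_norm_deriv_le_segment_01' (C := ‖d‖ / m)
    (f := fun u : ℝ => Complex.log (v + u * d)) (f' := fun u : ℝ => d / (v + u * d))
    (fun u hu => by
      have h1 : HasDerivAt (fun u : ℝ => v + u * d) d u := by
        simpa using ((Complex.ofRealCLM.hasDerivAt (x := u)).mul_const d).const_add v
      exact (h1.clog_real (hs u hu)).hasDerivWithinAt)
    (fun u hu => by
      rw [norm_div]
      exact div_le_div_of_nonneg_left (norm_nonneg _) hm (hn u (Set.Ico_subset_Icc_self hu)))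
  simpa using this

lemma cpa_step (v : ℂ) (hv : 1/4 ≤ v.re) :
    ‖1 / v - (Complex.log (v + 1) - Complex.log v)‖ ≤
      10 * (1 / (v.re + |v.im|) - 1 / (v.re + |v.im| + 1)) := by
  have hvn : 0 < ‖v‖ := by
    have := Complex.abs_re_le_norm v
    have := le_abs_self v.re
    linarith
  have hv0 : v ≠ 0 := norm_pos_iff.1 hvn
  have hge : ∀ u : ℝ, 0 ≤ u → ‖v‖ ≤ ‖v + u‖ := fun u hu => by
    apply (sq_le_sq₀ (norm_nonneg _) (norm_nonneg _)).1
    rw [← Complex.normSq_eq_norm_sq, ← Complex.normSq_eq_norm_sq, Complex.normSq_apply,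
      Complex.normSq_apply]
    simp
    nlinarith
  have := norm_image_sub_le_of_norm_deriv_le_segment_01' (C := 1 / ‖v‖^2)
    (f := fun u : ℝ => u * (1 / v) - Complex.log (v + u)) (f' := fun u : ℝ => 1 / v - 1 / (v + u))
    (fun u hu => by
      have h1 : HasDerivAt (fun u : ℝ => v + (u:ℂ)) 1 u := by
        simpa using ((Complex.ofRealCLM.hasDerivAt (x := u))).const_add v
      have h2 : HasDerivAt (fun u : ℝ => (u:ℂ) * (1 / v)) (1 / v) u := by
        simpa using ((Complex.ofRealCLM.hasDerivAt (x := u)).mul_const (1 / v))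
      have h3 : v + u ∈ Complex.slitPlane := by
        left
        have := hu.1
        simp; linarith
      exact (h2.sub (h1.clog_real h3)).hasDerivWithinAt)
    (fun u hu => by
      have hu' := hge u hu.1
      have h0 : v + u ≠ 0 := norm_pos_iff.1 (lt_of_lt_of_le hvn hu')
      have : 1 / v - 1 / (v + u) = u / (v * (v + u)) := by field_simp; ring
      rw [this, norm_div, norm_mul, Complex.norm_real, Real.norm_of_nonneg hu.1, sq]
      have := hu.2.le
      gcongr)
  have e : 1 / v - (Complex.log (v + 1) - Complex.log v) =
    ((1:ℝ) * (1 / v) - Complex.log (v + (1:ℝ))) - ((0:ℝ) * (1 / v) - Complex.log (v + (0:ℝ))) := by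
    simp; ring
  rw [e]
  refine this.trans ?_
  have hsq : ‖v‖^2 = v.re^2 + |v.im|^2 := by
    rw [← Complex.normSq_eq_norm_sq, Complex.normSq_apply, sq_abs]; ring
  have hy := abs_nonneg v.im
  rw [hsq]
  generalize |v.im| = y at *
  generalize v.re = x at *
  have : 10 * (1 / (x + y) - 1 / (x + y + 1)) = 10 / ((x + y) * (x + y + 1)) := by
    field_simp; ring
  rw [this, div_le_div_iff₀ (by positivity) (by positivity)]
  nlinarith [sq_nonneg (x - y)]

lemma cpa_sum (w : ℂ) (hw : 1/4 ≤ w.re) (n : ℕ) :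
    ‖(∑ k ∈ Finset.range n, 1 / (w + k)) - (Complex.log (w + n) - Complex.log w)‖ ≤
      10 * (1 / (w.re + |w.im|) - 1 / (w.re + |w.im| + n)) := by
  induction n with
  | zero => simp
  | succ n ih =>
    have h := cpa_step (w + n) (by simp; linarith [(Nat.cast_nonneg n : (0:ℝ) ≤ n)])
    rw [Finset.sum_range_succ]
    have e : (∑ k ∈ Finset.range n, 1 / (w + k)) + 1 / (w + n) -
        (Complex.log (w + (n + 1 : ℕ)) - Complex.log w) =
      ((∑ k ∈ Finset.range n, 1 / (w + k)) - (Complex.log (w + n) - Complex.log w)) +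
      (1 / (w + n) - (Complex.log (w + n + 1) - Complex.log (w + n))) := by
      push_cast; rw [← add_assoc]; ring
    rw [e]
    refine (norm_add_le _ _).trans ((add_le_add ih h).trans (le_of_eq ?_))
    simp only [Complex.add_re, Complex.natCast_re, Complex.add_im, Complex.natCast_im, add_zero]
    push_cast
    have e1 : w.re + n + |w.im| = w.re + |w.im| + n := by ring
    rw [e1, ← add_assoc]; ring

lemma cpa_tan_pos (w : ℂ) (hy : 0 < w.im) :
    Complex.cos (π * w / 2) ≠ 0 ∧ ‖Complex.tan (π * w / 2) - I‖ ≤ 2 / (π * w.im) := by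
  have hb : π * w.im ≤ ‖1 + Complex.exp (-(I * (π * w)))‖ := by
    have h1 : ‖Complex.exp (-(I * (π * w)))‖ = Real.exp (π * w.im) := by
      rw [Complex.norm_exp]; congr 1; simp
    have h2 := norm_sub_le (1 + Complex.exp (-(I * (π * w)))) 1
    rw [add_sub_cancel_left, h1, norm_one] at h2
    have h3 := Real.add_one_le_exp (π * w.im)
    linarith
  have hp : 0 < π * w.im := by positivity
  have hne : 1 + Complex.exp (-(I * (π * w))) ≠ 0 := norm_pos_iff.1 (lt_of_lt_of_le hp hb)
  have hc : Complex.cos (π * w / 2) =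
      Complex.exp (π * w / 2 * I) * (1 + Complex.exp (-(I * (π * w)))) / 2 := by
    rw [Complex.cos, mul_add, ← Complex.exp_add]
    ring_nf
  have hc0 : Complex.cos (π * w / 2) ≠ 0 := by
    rw [hc]
    exact div_ne_zero (mul_ne_zero (Complex.exp_ne_zero _) hne) two_ne_zero
  refine ⟨hc0, ?_⟩
  have : Complex.tan (π * w / 2) - I = -2 * I / (1 + Complex.exp (-(I * (π * w)))) := by
    rw [Complex.tan_eq_sin_div_cos, div_sub' hc0, div_eq_div_iff hc0 hne]
    have : Complex.sin (π * w / 2) - Complex.cos (π * w / 2) * I =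
        -I * Complex.exp (π * w / 2 * I) := by
      rw [Complex.exp_mul_I]
      linear_combination Complex.sin (π * w / 2) * I_sq
    rw [this, hc]
    ring
  rw [this, norm_div]
  simp
  gcongr

lemma cpa_tan (w : ℂ) (σ : ℝ) (hσ : σ = 1 ∨ σ = -1) (hy : 0 < σ * w.im) :
    Complex.cos (π * w / 2) ≠ 0 ∧
      ‖Complex.tan (π * w / 2) - σ * I‖ ≤ 2 / (π * (σ * w.im)) := by
  rcases hσ with rfl | rfl
  · simpa using cpa_tan_pos w (by simpa using hy)
  · have h := cpa_tan_pos (-w) (by simpa using hy)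
    have e : (π : ℂ) * -w / 2 = -(π * w / 2) := by ring
    rw [e, Complex.cos_neg, Complex.tan_neg] at h
    refine ⟨h.1, ?_⟩
    have h2 := h.2
    rw [← norm_neg]
    have e1 : -(Complex.tan (π * w / 2) - ((-1 : ℝ) : ℂ) * I) = -Complex.tan (π * w / 2) - I := by
      push_cast; ring
    have e2 : (-1 : ℝ) * w.im = (-w).im := by simp
    rw [e1, e2]
    exact h2

noncomputable def cpaS (σ : ℝ) (w : ℂ) : ℂ :=
  (w - 1/2) * Complex.log w - w - σ * I * π / 2 * w

noncomputable def cpaH (σ : ℝ) (n : ℕ) (w : ℂ) : ℂ :=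
  Complex.cos (π * w / 2) * Complex.GammaSeq w n * Complex.exp (-cpaS σ w)

lemma cpa_ld_mul {f g : ℂ → ℂ} {a b w : ℂ} (hf : HasDerivAt f (a * f w) w)
    (hg : HasDerivAt g (b * g w) w) :
    HasDerivAt (fun x => f x * g x) ((a + b) * (f w * g w)) w := by
  refine HasDerivAt.congr_deriv (hf.mul hg) ?_
  ring

lemma cpa_ld_inv {f : ℂ → ℂ} {a w : ℂ} (hf : HasDerivAt f (a * f w) w) (h0 : f w ≠ 0) :
    HasDerivAt (fun x => (f x)⁻¹) (-a * (f w)⁻¹) w := by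
  refine HasDerivAt.congr_deriv (hf.inv h0) ?_
  field_simp

lemma cpa_ld_prod (w : ℂ) (n : ℕ) (h : ∀ k : ℕ, w + k ≠ 0) :
    HasDerivAt (fun x => ∏ k ∈ Finset.range n, (x + (k:ℂ)))
      ((∑ k ∈ Finset.range n, 1 / (w + k)) * ∏ k ∈ Finset.range n, (w + (k:ℂ))) w := by
  induction n with
  | zero => simpa using hasDerivAt_const w (1:ℂ)
  | succ n ih =>
    simp only [Finset.prod_range_succ, Finset.sum_range_succ]
    apply cpa_ld_mul ih
    have := h n
    refine HasDerivAt.congr_deriv ((hasDerivAt_id w).add_const (n:ℂ)) ?_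
    field_simp

lemma cpa_ne (w : ℂ) (hw : 1/4 ≤ w.re) (k : ℕ) : w + k ≠ 0 := by
  intro h
  have := congrArg Complex.re h
  simp at this
  linarith [(Nat.cast_nonneg k : (0:ℝ) ≤ k)]

lemma cpa_seq (w : ℂ) (hw : 1/4 ≤ w.re) (n : ℕ) (hn : 0 < n) :
    HasDerivAt (fun x => Complex.GammaSeq x n)
      ((Real.log n - ∑ k ∈ Finset.range (n + 1), 1 / (w + k)) * Complex.GammaSeq w n) w ∧
    Complex.GammaSeq w n ≠ 0 := by
  have hne := cpa_ne w hw
  have hp : ∏ k ∈ Finset.range (n + 1), (w + (k:ℂ)) ≠ 0 := Finset.prod_ne_zero_iff.2 fun k _ => hne k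
  have hnc : (n:ℂ) ≠ 0 := by exact_mod_cast hn.ne'
  constructor
  · have h1 : HasDerivAt (fun x : ℂ => (n:ℂ) ^ x * (n.factorial : ℂ))
        (Real.log n * ((n:ℂ) ^ w * (n.factorial : ℂ))) w := by
      have := ((hasDerivAt_id w).const_cpow (Or.inl hnc)).mul_const (n.factorial : ℂ)
      refine HasDerivAt.congr_deriv (this) ?_
      rw [Complex.natCast_log]; simp; ring
    have := cpa_ld_mul h1 (cpa_ld_inv (cpa_ld_prod w (n+1) hne) hp)
    simpa only [Complex.GammaSeq, div_eq_mul_inv, sub_eq_add_neg] using this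
  · unfold Complex.GammaSeq
    refine div_ne_zero (mul_ne_zero ?_ ?_) hp
    · simp [Complex.cpow_eq_zero_iff, hnc]
    · exact_mod_cast n.factorial_ne_zero

noncomputable def cpaG (σ : ℝ) (n : ℕ) (w : ℂ) : ℂ :=
  -(π / 2) * Complex.tan (π * w / 2) + (Real.log n - ∑ k ∈ Finset.range (n + 1), 1 / (w + k)) +
    -(Complex.log w - 1 / (2 * w) - σ * I * π / 2)

lemma cpa_H (σ : ℝ) (hσ : σ = 1 ∨ σ = -1) (w : ℂ) (hw : 1/4 ≤ w.re) (hy : 0 < σ * w.im)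
    (n : ℕ) (hn : 0 < n) :
    HasDerivAt (cpaH σ n) (cpaG σ n w * cpaH σ n w) w ∧ cpaH σ n w ≠ 0 := by
  obtain ⟨hc, -⟩ := cpa_tan w σ hσ hy
  obtain ⟨h2, h20⟩ := cpa_seq w hw n hn
  have hw0 : w ≠ 0 := by simpa using cpa_ne w hw 0
  have hsl : w ∈ Complex.slitPlane := by left; linarith
  constructor
  · have h1 : HasDerivAt (fun x : ℂ => Complex.cos (π * x / 2))
        ((-(π / 2) * Complex.tan (π * w / 2)) * Complex.cos (π * w / 2)) w := by
      have := (((hasDerivAt_id w).const_mul (π:ℂ)).div_const 2).ccos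
      refine HasDerivAt.congr_deriv (this) ?_
      rw [mul_assoc, Complex.tan_mul_cos hc]; simp; ring
    have h3 : HasDerivAt (fun x : ℂ => Complex.exp (-cpaS σ x))
        (-(Complex.log w - 1 / (2 * w) - σ * I * π / 2) * Complex.exp (-cpaS σ w)) w := by
      have hS : HasDerivAt (cpaS σ) (Complex.log w - 1 / (2 * w) - σ * I * π / 2) w := by
        have := ((((hasDerivAt_id w).sub_const (1/2)).mul ((hasDerivAt_id w).clog hsl)).sub
          (hasDerivAt_id w)).sub ((hasDerivAt_id w).const_mul (σ * I * π / 2))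
        refine HasDerivAt.congr_deriv (this) ?_
        simp only [id]
        field_simp
        ring
      refine HasDerivAt.congr_deriv (hS.neg.cexp) ?_
      simp only [Pi.neg_apply]; ring
    exact cpa_ld_mul (cpa_ld_mul h1 h2) h3
  · exact mul_ne_zero (mul_ne_zero hc h20) (Complex.exp_ne_zero _)

lemma cpa_G (σ : ℝ) (hσ : σ = 1 ∨ σ = -1) (w : ℂ) (hw : 1/4 ≤ w.re) (m : ℝ) (hm : 0 < m)
    (hy : m ≤ σ * w.im) (n : ℕ) (hn : 0 < n) :
    ‖cpaG σ n w‖ ≤ 12 / m + ‖w + 1‖ / n := by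
  have hy' : |w.im| = σ * w.im := by
    rcases hσ with rfl | rfl
    · rw [abs_of_pos] <;> linarith
    · rw [abs_of_neg] <;> linarith
  obtain ⟨-, h1⟩ := cpa_tan w σ hσ (hm.trans_le hy)
  have h2 := cpa_sum w hw (n + 1)
  have hnr : (0:ℝ) < n := by exact_mod_cast hn
  have h3 : ‖Complex.log (n + (w + 1)) - Complex.log n‖ ≤ ‖w + 1‖ / n := by
    have hre : ∀ u ∈ Set.Icc (0:ℝ) 1, (n:ℝ) ≤ ((n:ℂ) + u * (w + 1)).re := fun u hu => by
      simp
      have := hu.1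
      nlinarith
    refine cpa_logdiff n (w + 1) n hnr (fun u hu => ?_) (fun u hu => ?_)
    · left; linarith [hre u hu]
    · exact (hre u hu).trans ((le_abs_self _).trans (Complex.abs_re_le_norm _))
  have e : cpaG σ n w = -(π / 2) * (Complex.tan (π * w / 2) - σ * I) +
      -((∑ k ∈ Finset.range (n + 1), 1 / (w + k)) -
        (Complex.log (w + (n + 1 : ℕ)) - Complex.log w)) +
      -(Complex.log (n + (w + 1)) - Complex.log n) + 1 / (2 * w) := by
    have : w + (n + 1 : ℕ) = n + (w + 1) := by push_cast; ring
    rw [this, cpaG, Complex.natCast_log]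
    ring
  have hmw : m ≤ ‖w‖ := by
    have := Complex.abs_im_le_norm w
    linarith
  have b1 : ‖-((π:ℂ) / 2) * (Complex.tan (π * w / 2) - σ * I)‖ ≤ 1 / m := by
    rw [norm_mul]
    have : ‖-((π:ℂ) / 2)‖ = π / 2 := by simp [abs_of_pos Real.pi_pos]
    rw [this]
    calc π / 2 * _ ≤ π / 2 * (2 / (π * (σ * w.im))) := by gcongr
      _ = 1 / (σ * w.im) := by field_simp
      _ ≤ 1 / m := by gcongr
  have b2 : 10 * (1 / (w.re + |w.im|) - 1 / (w.re + |w.im| + (n + 1 : ℕ))) ≤ 10 / m := by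
    have : 1 / (w.re + |w.im|) ≤ 1 / m := by
      apply one_div_le_one_div_of_le hm; linarith
    have : 0 ≤ 1 / (w.re + |w.im| + (n + 1 : ℕ)) := by
      have := abs_nonneg w.im
      positivity
    have : 10 / m = 10 * (1 / m) := by ring
    linarith
  have b4 : ‖1 / (2 * w)‖ ≤ 1 / m := by
    rw [norm_div, norm_mul]
    simp only [norm_one, Complex.norm_ofNat]
    apply one_div_le_one_div_of_le hm; linarith
  rw [e]
  refine (norm_add_le _ _).trans ?_
  have c1 := norm_add₃_le (a := -((π:ℂ) / 2) * (Complex.tan (π * w / 2) - σ * I))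
    (b := -((∑ k ∈ Finset.range (n + 1), 1 / (w + k)) -
        (Complex.log (w + (n + 1 : ℕ)) - Complex.log w)))
    (c := -(Complex.log (n + (w + 1)) - Complex.log n))
  rw [norm_neg (_ - (Complex.log (w + (n + 1 : ℕ)) - Complex.log w)),
    norm_neg (Complex.log (n + (w + 1)) - Complex.log n)] at c1
  have : 12 / m = 1 / m + 10 / m + 1 / m := by ring
  linarith

lemma cpa_ratio_n (σ : ℝ) (hσ : σ = 1 ∨ σ = -1) (z w : ℂ) (hz : 1/4 ≤ z.re) (hw : 1/4 ≤ w.re)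
    (m : ℝ) (hm : 0 < m) (hyz : m ≤ σ * z.im) (hyw : m ≤ σ * w.im) (n : ℕ) (hn : 0 < n) :
    ‖cpaH σ n z / cpaH σ n w - 1‖ ≤
      Real.exp (‖z - w‖ * (12 / m + (‖w‖ + ‖z - w‖ + 1) / n)) - 1 := by
  have hre : ∀ u ∈ Set.Icc (0:ℝ) 1, 1/4 ≤ (w + u * (z - w)).re := fun u hu => by
    simp; nlinarith [hu.1, hu.2]
  have him : ∀ u ∈ Set.Icc (0:ℝ) 1, m ≤ σ * (w + u * (z - w)).im := fun u hu => by
    simp; nlinarith [hu.1, hu.2]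
  have hw0 := (cpa_H σ hσ w hw (hm.trans_le hyw) n hn).2
  have := cpa_gron (fun u => cpaH σ n (w + u * (z - w)) / cpaH σ n w)
    (fun u => (z - w) * cpaG σ n (w + u * (z - w)))
    (‖z - w‖ * (12 / m + (‖w‖ + ‖z - w‖ + 1) / n)) (by simp [hw0])
    (fun u hu => by
      have h1 : HasDerivAt (fun u : ℝ => w + u * (z - w)) (z - w) u := by
        simpa using ((Complex.ofRealCLM.hasDerivAt (x := u)).mul_const (z - w)).const_add w
      have h2 := (cpa_H σ hσ _ (hre u hu) (hm.trans_le (him u hu)) n hn).1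
      have h3 := (h2.comp u h1).div_const (cpaH σ n w)
      refine HasDerivAt.congr_deriv (h3) ?_
      ring)
    (fun u hu => by
      rw [norm_mul]
      have h1 := cpa_G σ hσ _ (hre u hu) m hm (him u hu) n hn
      have h2 : ‖w + u * (z - w) + 1‖ ≤ ‖w‖ + ‖z - w‖ + 1 := by
        refine norm_add₃_le.trans ?_
        rw [norm_mul, Complex.norm_real, Real.norm_of_nonneg hu.1, norm_one]
        nlinarith [hu.2, norm_nonneg (z - w)]
      gcongr
      refine h1.trans ?_
      gcongr)
  simpa using this

lemma cpa_ratio (σ : ℝ) (hσ : σ = 1 ∨ σ = -1) (z w : ℂ) (hz : 1/4 ≤ z.re) (hw : 1/4 ≤ w.re)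
    (m : ℝ) (hm : 0 < m) (hyz : m ≤ σ * z.im) (hyw : m ≤ σ * w.im) :
    ‖(Complex.cos (π * z / 2) * Complex.Gamma z * Complex.exp (-cpaS σ z)) /
      (Complex.cos (π * w / 2) * Complex.Gamma w * Complex.exp (-cpaS σ w)) - 1‖ ≤
      Real.exp (‖z - w‖ * (12 / m)) - 1 := by
  have hd : Complex.cos (π * w / 2) * Complex.Gamma w * Complex.exp (-cpaS σ w) ≠ 0 :=
    mul_ne_zero (mul_ne_zero (cpa_tan w σ hσ (hm.trans_le hyw)).1
      (Complex.Gamma_ne_zero_of_re_pos (by linarith))) (Complex.exp_ne_zero _)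
  have t : ∀ v, Filter.Tendsto (fun n => cpaH σ n v) Filter.atTop
      (nhds (Complex.cos (π * v / 2) * Complex.Gamma v * Complex.exp (-cpaS σ v))) := fun v =>
    ((Complex.GammaSeq_tendsto_Gamma v).const_mul _).mul_const _
  have t1 := (((t z).div (t w) hd).sub_const 1).norm
  have t2 : Filter.Tendsto (fun n : ℕ =>
      Real.exp (‖z - w‖ * (12 / m + (‖w‖ + ‖z - w‖ + 1) / n)) - 1) Filter.atTop
      (nhds (Real.exp (‖z - w‖ * (12 / m + 0)) - 1)) := by
    refine Filter.Tendsto.sub_const ((Real.continuous_exp.tendsto _).comp ?_) 1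
    exact ((tendsto_const_div_atTop_nhds_zero_nat _).const_add _).const_mul _
  rw [add_zero] at t2
  refine le_of_tendsto_of_tendsto t1 t2 ?_
  filter_upwards [Filter.eventually_gt_atTop 0] with n hn
  exact cpa_ratio_n σ hσ z w hz hw m hm hyz hyw n hn

lemma cpa_logq (z w : ℂ) (hz : 0 < z.re) (hw : 0 < w.re) :
    Complex.log (w / z) = Complex.log w - Complex.log z := by
  have hz0 : z ≠ 0 := by rintro rfl; simp at hz
  have hw0 : w ≠ 0 := by rintro rfl; simp at hw
  have h1 := abs_lt.1 (Complex.abs_arg_lt_pi_div_two_iff.2 (Or.inl hz))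
  have h2 := abs_lt.1 (Complex.abs_arg_lt_pi_div_two_iff.2 (Or.inl hw))
  have e : w / z = Complex.exp (Complex.log w - Complex.log z) := by
    rw [Complex.exp_sub, Complex.exp_log hw0, Complex.exp_log hz0]
  rw [e, Complex.log_exp] <;> simp only [Complex.sub_im, Complex.log_im] <;> linarith

lemma cpa_logim (σ : ℝ) (hσ : σ = 1 ∨ σ = -1) (w : ℂ) (hw : 0 < w.re) (hy : 0 < σ * w.im) :
    ‖Complex.log w - (Real.log (σ * w.im) + σ * I * π / 2)‖ ≤ w.re / (σ * w.im) := by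
  have hlog : Complex.log (w.im * I) = Real.log (σ * w.im) + σ * I * π / 2 := by
    rcases hσ with rfl | rfl
    · rw [Complex.log_ofReal_mul (by linarith) I_ne_zero, Complex.log_I]
      simp; ring
    · have : (w.im : ℂ) * I = ((-w.im : ℝ) : ℂ) * (-I) := by push_cast; ring
      rw [this, Complex.log_ofReal_mul (by linarith) (neg_ne_zero.2 I_ne_zero), Complex.log_neg_I]
      simp; ring
  have hne : w.im ≠ 0 := by rintro h; simp [h] at hy
  have hab : σ * w.im = |w.im| := by
    rcases hσ with rfl | rfl
    · rw [abs_of_pos] <;> linarith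
    · rw [abs_of_neg] <;> linarith
  have := cpa_logdiff (w.im * I) w.re (σ * w.im) hy
    (fun u hu => by right; simpa using hne)
    (fun u hu => by
      have := Complex.abs_im_le_norm ((w.im : ℂ) * I + u * w.re)
      rw [hab]
      simpa using this)
  rw [hlog, add_comm ((w.im : ℂ) * I), Complex.re_add_im] at this
  simpa [abs_of_pos hw] using this

lemma cpa_chi (z w : ℂ) (hw : 0 < w.re) (hw1 : w.re < 1) :
    fnEqChi (1 - z) * fnEqChi w =
      Complex.exp ((w - z) * Real.log (2 * π)) *
        ((Complex.cos (π * z / 2) * Complex.Gamma z) /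
          (Complex.cos (π * w / 2) * Complex.Gamma w)) := by
  have hG := Complex.Gamma_ne_zero_of_re_pos hw
  have hG1 : Complex.Gamma (1 - w) ≠ 0 := Complex.Gamma_ne_zero_of_re_pos (by simp; linarith)
  have hr := Complex.Gamma_mul_Gamma_one_sub w
  have hpi : (π : ℂ) ≠ 0 := by exact_mod_cast Real.pi_ne_zero
  have hs : Complex.sin (π * w) ≠ 0 := by
    intro h
    rw [h, div_zero] at hr
    exact mul_ne_zero hG hG1 hr
  have hs2 : Complex.sin (π * w) = 2 * Complex.sin (π * w / 2) * Complex.cos (π * w / 2) := by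
    rw [← Complex.sin_two_mul]; congr 1; ring
  have hc : Complex.cos (π * w / 2) ≠ 0 := by
    intro h; rw [hs2, h] at hs; simp at hs
  have hr' : Complex.sin (π * w / 2) * Complex.Gamma (1 - w) =
      π / 2 / (Complex.cos (π * w / 2) * Complex.Gamma w) := by
    rw [eq_div_iff hs, hs2] at hr
    rw [eq_div_iff (mul_ne_zero hc hG)]
    linear_combination hr / 2
  have e1 : Complex.sin (π * (1 - z) / 2) = Complex.cos (π * z / 2) := by
    rw [← Complex.sin_pi_div_two_sub]; congr 1; ring
  have e2 : Complex.exp ((w - z) * Real.log (2 * π)) * 2 / π =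
      2 ^ (1 - z) * (π : ℂ) ^ (1 - z - 1) * (2 ^ w * (π : ℂ) ^ (w - 1)) := by
    rw [Real.log_mul two_ne_zero Real.pi_ne_zero]
    have h2 : (2:ℂ) = Complex.exp (Real.log 2 : ℝ) := by
      rw [← Complex.ofReal_exp, Real.exp_log two_pos]; simp
    have hp : (π:ℂ) = Complex.exp (Real.log π : ℝ) := by
      rw [← Complex.ofReal_exp, Real.exp_log Real.pi_pos]
    have l2 : Complex.log 2 = (Real.log 2 : ℝ) := by
      rw [Complex.ofReal_log two_pos.le]; simp
    have lp : Complex.log π = (Real.log π : ℝ) := by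
      rw [Complex.ofReal_log Real.pi_pos.le]
    rw [Complex.cpow_def_of_ne_zero two_ne_zero, Complex.cpow_def_of_ne_zero hpi,
      Complex.cpow_def_of_ne_zero two_ne_zero, Complex.cpow_def_of_ne_zero hpi, l2, lp]
    rw [div_eq_iff hpi]
    have : Complex.exp ((w - z) * ((Real.log 2 + Real.log π : ℝ) : ℂ)) * Complex.exp (Real.log 2 : ℝ) =
      Complex.exp ((Real.log 2 : ℝ) * (1 - z)) * Complex.exp ((Real.log π : ℝ) * (1 - z - 1)) *
      (Complex.exp ((Real.log 2 : ℝ) * w) * Complex.exp ((Real.log π : ℝ) * (w - 1))) *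
        Complex.exp (Real.log π : ℝ) := by
      simp only [← Complex.exp_add]
      congr 1
      push_cast
      ring
    rwa [← h2, ← hp] at this
  unfold fnEqChi
  rw [e1, sub_sub_cancel]
  calc _ = (2 ^ (1 - z) * (π : ℂ) ^ (1 - z - 1) * (2 ^ w * (π : ℂ) ^ (w - 1))) *
        (Complex.cos (π * z / 2) * Complex.Gamma z) *
        (Complex.sin (π * w / 2) * Complex.Gamma (1 - w)) := by ring
    _ = _ := by
      rw [← e2, hr']
      field_simp

lemma cpa_expE (δ e : ℂ) (x : ℝ) (he : ‖e‖ ≤ Real.exp x - 1) :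
    ‖Complex.exp δ * (1 + e) - 1‖ ≤ Real.exp (‖δ‖ + x) - 1 := by
  have h1 := Complex.norm_exp_le_exp_norm δ
  have h2 := Complex.norm_exp_sub_sum_le_exp_norm_sub_sum δ 1
  simp at h2
  have : Complex.exp δ * (1 + e) - 1 = (Complex.exp δ - 1) + Complex.exp δ * e := by ring
  rw [this, Real.exp_add]
  refine (norm_add_le _ _).trans ?_
  rw [norm_mul]
  have := mul_le_mul h1 he (norm_nonneg _) (Real.exp_pos _).le
  linarith

theorem chi_product_asymptotic :
    ∃ C : ℝ, 0 < C ∧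
      ∀ a b : ℂ, |a.re| ≤ 1 / 4 → |b.re| ≤ 1 / 4 →
        ∀ t : ℝ, 10 * ‖a - b‖ < |t + a.im| → 10 * ‖a - b‖ < |t + b.im| →
          ∃ E : ℂ,
            fnEqChi (1 / 2 + a + t * I) * fnEqChi (1 / 2 - b - t * I) =
              Complex.exp (-(a - b) * Real.log (|t + b.im| / (2 * Real.pi)) +
                  (a + t * I) * Complex.log (1 + (a - b) / (1 / 2 - a - t * I)) +
                  (a - b)) * (1 + E) ∧
            ‖E‖ ≤ C * ‖a - b‖ / |t + a.im| := by
  refine ⟨26 * Real.exp 3, by positivity, fun a b ha hb t hta htb => ?_⟩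
  set c := a - b with hc
  set z : ℂ := 1 / 2 - a - t * I with hz
  set w : ℂ := 1 / 2 - b - t * I with hw
  have hwz : w - z = c := by rw [hw, hz, hc]; ring
  have hzre : z.re = 1 / 2 - a.re := by simp [hz]
  have hwre : w.re = 1 / 2 - b.re := by simp [hw]
  have hzim : z.im = -(t + a.im) := by simp [hz]; ring
  have hwim : w.im = -(t + b.im) := by simp [hw]; ring
  obtain ⟨ha1, ha2⟩ := abs_le.1 ha
  obtain ⟨hb1, hb2⟩ := abs_le.1 hb
  have hcn := norm_nonneg c
  have hτ : 0 < |t + a.im| := by linarith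
  obtain ⟨σ, hσ, hσz⟩ : ∃ σ : ℝ, (σ = 1 ∨ σ = -1) ∧ σ * z.im = |t + a.im| := by
    rcases le_total 0 (t + a.im) with h | h
    · exact ⟨-1, Or.inr rfl, by rw [abs_of_nonneg h, hzim]; ring⟩
    · exact ⟨1, Or.inl rfl, by rw [abs_of_nonpos h, hzim]; ring⟩
  have hσw1 : |t + a.im| / 2 ≤ σ * w.im := by
    have h1 := abs_le.1 (Complex.abs_im_le_norm c)
    have h2 : w.im = z.im + c.im := by rw [← hwz]; simp
    rw [h2, mul_add, hσz]
    rcases hσ with rfl | rfl <;> linarith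
  have hσw : σ * w.im = |t + b.im| := by
    rw [← abs_of_pos (show 0 < σ * w.im by linarith), abs_mul, hwim, abs_neg]
    rcases hσ with rfl | rfl <;> simp
  have hm : 0 < |t + a.im| / 2 := by linarith
  set m := |t + a.im| / 2 with hmdef
  have hR := cpa_ratio σ hσ z w (by linarith) (by linarith) m hm (by linarith) hσw1
  have hL := cpa_logim σ hσ w (by linarith) (by linarith)
  have hP := cpa_chi z w (by linarith) (by linarith)
  have hcw : Complex.cos (π * w / 2) ≠ 0 := (cpa_tan w σ hσ (by linarith)).1
  have hGw : Complex.Gamma w ≠ 0 := Complex.Gamma_ne_zero_of_re_pos (by linarith)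
  have hz0 : z ≠ 0 := by intro h; rw [h] at hzre; simp at hzre; linarith
  have hQ : Complex.log (1 + c / z) = Complex.log w - Complex.log z := by
    rw [← cpa_logq z w (by linarith) (by linarith), ← hwz]
    congr 1; field_simp; ring
  set e := (Complex.cos (π * z / 2) * Complex.Gamma z * Complex.exp (-cpaS σ z)) /
      (Complex.cos (π * w / 2) * Complex.Gamma w * Complex.exp (-cpaS σ w)) - 1 with he
  set δ := -c * (Complex.log w - (Real.log (σ * w.im) + σ * I * π / 2)) with hδ
  have hzw : ‖z - w‖ = ‖c‖ := by rw [← hwz, norm_sub_rev]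
  rw [hzw] at hR
  refine ⟨Complex.exp δ * (1 + e) - 1, ?_, ?_⟩
  · have e1 : (1 / 2 + a + t * I : ℂ) = 1 - z := by rw [hz]; ring
    have e3 : a + t * I = 1 / 2 - z := by rw [hz]; ring
    rw [e1, hP, e3, hQ, hwz, add_sub_cancel, ← mul_assoc, ← Complex.exp_add]
    have e2 : (Complex.cos (π * z / 2) * Complex.Gamma z) /
          (Complex.cos (π * w / 2) * Complex.Gamma w) =
        Complex.exp (cpaS σ z - cpaS σ w) * (1 + e) := by
      rw [he, add_sub_cancel, Complex.exp_sub, Complex.exp_neg, Complex.exp_neg]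
      have := Complex.exp_ne_zero (cpaS σ z)
      have := Complex.exp_ne_zero (cpaS σ w)
      field_simp
    rw [e2, ← mul_assoc, ← Complex.exp_add]
    congr 2
    rw [hδ, ← hσw, Real.log_div (by linarith) (by positivity)]
    unfold cpaS
    rw [← hwz]
    push_cast
    ring
  · refine (cpa_expE δ e _ hR).trans ?_
    have hd : ‖δ‖ ≤ ‖c‖ * (1 / m) := by
      rw [hδ, norm_mul, norm_neg]
      gcongr
      refine hL.trans ?_
      gcongr
      linarith
    set x := 26 * ‖c‖ / |t + a.im| with hx
    have hx0 : 0 ≤ x := by positivity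
    have hx3 : x ≤ 3 := by
      rw [hx, div_le_iff₀ hτ]; linarith
    have hle : ‖δ‖ + ‖c‖ * (12 / m) ≤ x := by
      have : x = ‖c‖ * (1 / m) + ‖c‖ * (12 / m) := by
        rw [hx, hmdef]; field_simp; ring
      linarith
    have h1 : Real.exp (‖δ‖ + ‖c‖ * (12 / m)) ≤ Real.exp x := Real.exp_le_exp.2 hle
    have h2 : Real.exp x - 1 ≤ x * Real.exp x := by
      have := Real.add_one_le_exp (-x)
      have h3 : Real.exp (-x) * Real.exp x = 1 := by rw [← Real.exp_add]; simp
      nlinarith [Real.exp_pos x]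
    have h4 : x * Real.exp x ≤ x * Real.exp 3 := by gcongr
    have h5 : 26 * Real.exp 3 * ‖c‖ / |t + a.im| = x * Real.exp 3 := by rw [hx]; ring
    rw [h5]; linarith
end

section
/- There exists a constant C > 0 such that for every s ∈ ℂ with |Re s| ≤ 1/log(|Im s| + 4), one has |ζ(s)| ≤ C (|Im s| + 2)^{1/2} log(|Im s| + 2). -/
open Complex Real

lemma zb_mellin_bdd {f : ℝ → ℂ} {a b : ℝ} (ha : MellinConvergent f a) (hb : MellinConvergent f b) :
    ∃ M : ℝ, ∀ s : ℂ, a ≤ s.re → s.re ≤ b → ‖mellin f s‖ ≤ M := by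
  refine ⟨∫ t : ℝ in Set.Ioi 0, (‖(t : ℂ) ^ ((a : ℂ) - 1) • f t‖ + ‖(t : ℂ) ^ ((b : ℂ) - 1) • f t‖), ?_⟩
  intro s h1 h2
  unfold mellin
  refine MeasureTheory.norm_integral_le_of_norm_le (ha.norm.add hb.norm) ?_
  refine (MeasureTheory.ae_restrict_iff' measurableSet_Ioi).2 (Filter.Eventually.of_forall ?_)
  intro t ht
  have ht : 0 < t := ht
  simp only [norm_smul, Complex.norm_cpow_eq_rpow_re_of_pos ht]
  rw [← add_mul]
  refine mul_le_mul_of_nonneg_right ?_ (norm_nonneg _)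
  simp only [Complex.sub_re, Complex.ofReal_re, Complex.one_re]
  have p1 : 0 ≤ t ^ (a - 1) := (Real.rpow_pos_of_pos ht _).le
  have p2 : 0 ≤ t ^ (b - 1) := (Real.rpow_pos_of_pos ht _).le
  rcases le_total 1 t with h | h
  · have := Real.rpow_le_rpow_of_exponent_le h (show s.re - 1 ≤ b - 1 by linarith)
    linarith
  · have := Real.rpow_le_rpow_of_exponent_ge ht h (show a - 1 ≤ s.re - 1 by linarith)
    linarith

lemma zb_Gamma_bdd {a b : ℝ} (ha : 0 < a) (hab : a ≤ b) :
    ∃ M : ℝ, ∀ s : ℂ, a ≤ s.re → s.re ≤ b → ‖Complex.Gamma s‖ ≤ M := by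
  have key : ∀ c : ℝ, 0 < c → MellinConvergent (fun x => ((Real.exp (-x) : ℝ) : ℂ)) c := by
    intro c hc
    have := Complex.GammaIntegral_convergent (s := (c : ℂ)) (by simpa using hc)
    unfold MellinConvergent
    refine this.congr_fun ?_ measurableSet_Ioi
    intro x _
    simp [mul_comm]
  obtain ⟨M, hM⟩ := zb_mellin_bdd (key a ha) (key b (by linarith))
  refine ⟨M, fun s h1 h2 => ?_⟩
  rw [Complex.Gamma_eq_integral (by linarith), Complex.GammaIntegral_eq_mellin]
  exact hM s h1 h2

lemma zb_Lambda_bdd (a b : ℝ) :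
    ∃ M : ℝ, ∀ s : ℂ, a ≤ s.re → s.re ≤ b → ‖completedRiemannZeta₀ s‖ ≤ M := by
  let P := HurwitzZeta.hurwitzEvenFEPair 0
  obtain ⟨M, hM⟩ := zb_mellin_bdd (f := P.f_modif)
    (P.isStrongFEPair_toStrongFEPair.hasMellin ((a / 2 : ℝ) : ℂ)).1
    (P.isStrongFEPair_toStrongFEPair.hasMellin ((b / 2 : ℝ) : ℂ)).1
  refine ⟨M / 2, fun s h1 h2 => ?_⟩
  have e : completedRiemannZeta₀ s = mellin P.f_modif (s / 2) / 2 := rfl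
  have r : (s / 2).re = s.re / 2 := by simp
  rw [e, norm_div]
  have := hM (s / 2) (by rw [r]; linarith) (by rw [r]; linarith)
  simp only [Complex.norm_ofNat]
  linarith

lemma zb_exp_le (z : ℂ) : ‖Complex.exp (z * I)‖ ≤ Real.exp |z.im| := by
  rw [Complex.norm_exp]
  simp
  exact neg_le_abs _

lemma zb_sin_le (z : ℂ) : ‖Complex.sin z‖ ≤ Real.exp |z.im| := by
  have h1 := zb_exp_le z
  have h2 := zb_exp_le (-z)
  simp only [Complex.neg_im, abs_neg] at h2
  rw [Complex.sin, norm_div, norm_mul, Complex.norm_I, mul_one, Complex.norm_ofNat]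
  have := norm_sub_le (Complex.exp (-z * I)) (Complex.exp (z * I))
  linarith

lemma zb_cos_le (z : ℂ) : ‖Complex.cos z‖ ≤ Real.exp |z.im| := by
  have h1 := zb_exp_le z
  have h2 := zb_exp_le (-z)
  simp only [Complex.neg_im, abs_neg] at h2
  rw [Complex.cos, norm_div, Complex.norm_ofNat]
  have := norm_add_le (Complex.exp (z * I)) (Complex.exp (-z * I))
  linarith

lemma zb_zeta_growth : ∃ K : ℝ, 0 ≤ K ∧ ∀ s : ℂ, -(1 / 2) ≤ s.re → s.re ≤ 3 / 2 → 1 ≤ |s.im| →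
    ‖riemannZeta s‖ ≤ K * Real.exp (2 * |s.im|) := by
  obtain ⟨A, hA⟩ := zb_Lambda_bdd (-(1 / 2)) (3 / 2)
  obtain ⟨B, hB⟩ := zb_Gamma_bdd (a := 1 / 4) (b := 5 / 4) (by norm_num) (by norm_num)
  have hA0 : 0 ≤ A := (norm_nonneg _).trans (hA 0 (by simp) (by norm_num))
  have hB0 : 0 ≤ B := (norm_nonneg _).trans (hB 1 (by norm_num) (by norm_num))
  refine ⟨(A + 2) * (π * B), by positivity, fun s h1 h2 h3 => ?_⟩
  have hn : 1 ≤ ‖s‖ := h3.trans (Complex.abs_im_le_norm s)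
  have hn' : 1 ≤ ‖1 - s‖ := by
    have := Complex.abs_im_le_norm (1 - s)
    simp at this
    linarith
  have hs0 : s ≠ 0 := by
    rintro rfl
    simp at hn
    linarith
  have hG := Complex.Gamma_mul_Gamma_one_sub (s / 2)
  have hsin : Complex.sin (π * (s / 2)) ≠ 0 := by
    rw [Complex.sin_ne_zero_iff]
    intro k hk
    have hpi : (π : ℂ) ≠ 0 := by exact_mod_cast Real.pi_ne_zero
    have : s = 2 * k := by
      rw [mul_comm (k : ℂ)] at hk
      have := mul_left_cancel₀ hpi hk
      rw [← this]; ring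
    rw [this] at h3
    simp at h3
    linarith
  have hpi : (π : ℂ) ≠ 0 := by exact_mod_cast Real.pi_ne_zero
  have hGne : Complex.Gamma (s / 2) ≠ 0 := by
    intro h
    rw [h, zero_mul] at hG
    exact div_ne_zero hpi hsin hG.symm
  have hinv : (Complex.Gamma (s / 2))⁻¹ = Complex.Gamma (1 - s / 2) * Complex.sin (π * (s / 2)) / π := by
    rw [eq_div_iff hsin] at hG
    refine inv_eq_of_mul_eq_one_right ?_
    rw [← mul_div_assoc, ← mul_assoc, hG, div_self hpi]
  rw [riemannZeta_eq_completedRiemannZeta₀ hs0, norm_div, norm_mul, div_eq_mul_inv]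
  have e1 : ‖completedRiemannZeta₀ s - 1 / s - 1 / (1 - s)‖ ≤ A + 2 := by
    have a1 := norm_sub_le (completedRiemannZeta₀ s - 1 / s) (1 / (1 - s))
    have a2 := norm_sub_le (completedRiemannZeta₀ s) (1 / s)
    have a3 : ‖1 / s‖ ≤ 1 := by rw [norm_div, norm_one]; exact div_le_one_of_le₀ hn (norm_nonneg _)
    have a4 : ‖1 / (1 - s)‖ ≤ 1 := by
      rw [norm_div, norm_one]; exact div_le_one_of_le₀ hn' (norm_nonneg _)
    linarith [hA s h1 h2]
  have e2 : (‖(π : ℂ) ^ (-s / 2)‖ * ‖Complex.Gamma (s / 2)‖)⁻¹ ≤ π * B * Real.exp (2 * |s.im|) := by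
    rw [mul_inv, ← norm_inv (Complex.Gamma _), hinv, Complex.norm_cpow_eq_rpow_re_of_pos Real.pi_pos,
      ← Real.rpow_neg Real.pi_pos.le, norm_div, norm_mul]
    have r : -(-s / 2).re = s.re / 2 := by simp; ring
    rw [r, mul_assoc]
    have p1 : π ^ (s.re / 2) ≤ π := by
      nth_rewrite 2 [← Real.rpow_one π]
      exact Real.rpow_le_rpow_of_exponent_le (by linarith [Real.pi_gt_three]) (by linarith)
    have p2 := hB (1 - s / 2) (by simp; linarith) (by simp; linarith)
    have p3 : ‖Complex.sin (π * (s / 2))‖ ≤ Real.exp (2 * |s.im|) := by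
      refine (zb_sin_le _).trans (Real.exp_le_exp.2 ?_)
      have : (π * (s / 2) : ℂ).im = π / 2 * s.im := by
        simp; ring
      rw [this, abs_mul, abs_of_pos (by positivity)]
      exact mul_le_mul_of_nonneg_right (by linarith [Real.pi_lt_four]) (abs_nonneg _)
    have p4 : ‖(π : ℂ)‖ = π := by simp [abs_of_pos Real.pi_pos]
    rw [p4]
    refine mul_le_mul p1 ?_ (by positivity) Real.pi_pos.le
    rw [div_le_iff₀ Real.pi_pos]
    calc _ ≤ B * Real.exp (2 * |s.im|) := mul_le_mul p2 p3 (norm_nonneg _) hB0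
      _ ≤ _ := le_mul_of_one_le_right (by positivity) (by linarith [Real.pi_gt_three])
  calc _ ≤ (A + 2) * (π * B * Real.exp (2 * |s.im|)) := mul_le_mul e1 e2 (by positivity) (by positivity)
    _ = _ := by ring

lemma zb_PL {f : ℂ → ℂ} {a b : ℝ} (hab : a < b) (hab2 : b - a ≤ 2) {K A C : ℝ} (hA : 0 ≤ A)
    (hd : DifferentiableOn ℂ f {z | a ≤ z.re})
    (hg : ∀ z : ℂ, a < z.re → z.re < b → 1 ≤ |z.im| → ‖f z‖ ≤ K * Real.exp (A * |z.im|))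
    (h1 : ∀ z : ℂ, z.re = a → ‖f z‖ ≤ C) (h2 : ∀ z : ℂ, z.re = b → ‖f z‖ ≤ C)
    {z : ℂ} (hza : a ≤ z.re) (hzb : z.re ≤ b) : ‖f z‖ ≤ C := by
  refine PhragmenLindelof.vertical_strip (a := a) (b := b) ?_ ⟨1, ?_, A, ?_⟩ h1 h2 hza hzb
  · refine DifferentiableOn.diffContOnCl (hd.mono ?_)
    refine closure_minimal (fun z hz => hz.1.le) ?_
    exact isClosed_le continuous_const Complex.continuous_re
  · rw [lt_div_iff₀ (by linarith)]
    linarith [Real.pi_gt_three]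
  · refine Asymptotics.IsBigO.of_bound |K| ?_
    have e1 : ∀ᶠ z : ℂ in Filter.comap (_root_.abs ∘ Complex.im) Filter.atTop ⊓
        Filter.principal (Complex.re ⁻¹' Set.Ioo a b), 1 ≤ |z.im| :=
      Filter.Eventually.filter_mono inf_le_left
        (Filter.tendsto_comap.eventually (Filter.eventually_ge_atTop (1 : ℝ)))
    have e2 : ∀ᶠ z : ℂ in Filter.comap (_root_.abs ∘ Complex.im) Filter.atTop ⊓
        Filter.principal (Complex.re ⁻¹' Set.Ioo a b), z ∈ Complex.re ⁻¹' Set.Ioo a b :=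
      Filter.Eventually.filter_mono inf_le_right (Filter.mem_principal_self _)
    filter_upwards [e1, e2] with z hz1 hz2
    refine (hg z hz2.1 hz2.2 hz1).trans ?_
    rw [Real.norm_of_nonneg (Real.exp_pos _).le, one_mul]
    refine mul_le_mul (le_abs_self K) (Real.exp_le_exp.2 ?_) (Real.exp_pos _).le (abs_nonneg _)
    exact mul_le_mul_of_nonneg_left (by linarith [Real.add_one_le_exp |z.im|]) hA

lemma zb_gauss (z : ℂ) (t : ℝ) (h1 : -(3 / 2) ≤ z.re) (h2 : z.re ≤ 3 / 2) :
    ‖Complex.exp ((z - t * I) ^ 2)‖ * (1 + |z.im - t|) ≤ 2 * Real.exp 3 := by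
  rw [Complex.norm_exp]
  have : ((z - t * I) ^ 2).re = z.re ^ 2 - |z.im - t| ^ 2 := by
    rw [sq_abs]; simp [pow_two]
  rw [this]
  set u := |z.im - t|
  have hu : 0 ≤ u := abs_nonneg _
  have a1 : 1 + u ≤ 2 * Real.exp (u ^ 2) := by
    have := Real.add_one_le_exp (u ^ 2)
    nlinarith [sq_nonneg (u - 1)]
  have a2 : z.re ^ 2 ≤ 3 := by nlinarith
  calc _ ≤ Real.exp (z.re ^ 2 - u ^ 2) * (2 * Real.exp (u ^ 2)) :=
        mul_le_mul_of_nonneg_left a1 (Real.exp_pos _).le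
    _ = 2 * Real.exp (z.re ^ 2) := by
        rw [Real.exp_sub]; field_simp
    _ ≤ _ := by gcongr

lemma zb_gauss' (z : ℂ) (t : ℝ) (h1 : -(3 / 2) ≤ z.re) (h2 : z.re ≤ 3 / 2) :
    ‖Complex.exp ((z - t * I) ^ 2)‖ ≤ 2 * Real.exp 3 :=
  (le_mul_of_one_le_right (norm_nonneg _) (by linarith [abs_nonneg (z.im - t)])).trans
    (zb_gauss z t h1 h2)

lemma zb_gauss_ge (z : ℂ) : 1 ≤ ‖Complex.exp ((z - z.im * I) ^ 2)‖ := by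
  rw [Complex.norm_exp]
  have : ((z - z.im * I) ^ 2).re = z.re ^ 2 := by simp [pow_two]
  rw [this]
  exact Real.one_le_exp (sq_nonneg _)

lemma zb_half (z : ℂ) (hz : z.re = 1 / 2) :
    ‖Complex.Gamma z * Complex.cos (π * z / 2)‖ ≤ 2 := by
  have hc : (starRingEnd ℂ) z = 1 - z := by
    apply Complex.ext <;> simp [hz] <;> norm_num
  have hsin : Complex.sin (π * z) ≠ 0 := by
    rw [Complex.sin_ne_zero_iff]
    intro k hk
    have hpi : (π : ℂ) ≠ 0 := by exact_mod_cast Real.pi_ne_zero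
    rw [mul_comm (k : ℂ)] at hk
    have := mul_left_cancel₀ hpi hk
    rw [this] at hz
    simp at hz
    have h2 : (2 * k : ℤ) = 1 := by
      have : (2 * k : ℝ) = 1 := by rw [hz]; norm_num
      exact_mod_cast this
    omega
  have h := Complex.mul_conj' (Complex.Gamma z * Complex.cos (π * z / 2))
  have e : Complex.cos (π * (1 - z) / 2) = Complex.sin (π * z / 2) := by
    rw [← Complex.cos_pi_div_two_sub]; congr 1; ring
  have e2 : (starRingEnd ℂ) (π * z / 2) = π * (1 - z) / 2 := by
    rw [map_div₀, map_mul, hc, map_ofNat, Complex.conj_ofReal]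
  have e3 : Complex.sin (π * z) = 2 * Complex.sin (π * z / 2) * Complex.cos (π * z / 2) := by
    rw [← Complex.sin_two_mul]; congr 1; ring
  rw [map_mul, ← Complex.Gamma_conj, ← Complex.cos_conj, hc, e2, e] at h
  have h' : Complex.Gamma z * Complex.cos (π * z / 2) * (Complex.Gamma (1 - z) * Complex.sin (π * z / 2))
      = π / 2 := by
    calc _ = (Complex.Gamma z * Complex.Gamma (1 - z)) * (Complex.sin (π * z / 2) * Complex.cos (π * z / 2)) := by ring
      _ = _ := by
        rw [Complex.Gamma_mul_Gamma_one_sub, div_mul_eq_mul_div, div_eq_iff hsin, e3]; ring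
  rw [h'] at h
  have h3 : π / 2 = ‖Complex.Gamma z * Complex.cos (π * z / 2)‖ ^ 2 := by exact_mod_cast h
  have := Real.pi_lt_four
  nlinarith [norm_nonneg (Complex.Gamma z * Complex.cos (π * z / 2))]

lemma zb_threehalf (z : ℂ) (hz : z.re = 3 / 2) :
    ‖Complex.Gamma z * Complex.cos (π * z / 2)‖ ≤ 2 * (1 / 2 + |z.im|) := by
  obtain ⟨w, rfl⟩ : ∃ w, z = w + 1 := ⟨z - 1, by ring⟩
  have hw : w.re = 1 / 2 := by simp at hz; linarith
  have hw0 : w ≠ 0 := by rintro rfl; simp at hw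
  have hc : (starRingEnd ℂ) w = 1 - w := by
    apply Complex.ext <;> simp [hw] <;> norm_num
  have e2 : (starRingEnd ℂ) (π * w / 2) = π / 2 - π * w / 2 := by
    rw [map_div₀, map_mul, hc, map_ofNat, Complex.conj_ofReal]; ring
  have e : Complex.cos (π * (w + 1) / 2) = - (starRingEnd ℂ) (Complex.cos (π * w / 2)) := by
    rw [← Complex.cos_conj, e2, Complex.cos_pi_div_two_sub, ← Complex.cos_add_pi_div_two]
    congr 1; ring
  rw [Complex.Gamma_add_one _ hw0, e, norm_mul, norm_mul, norm_neg, RCLike.norm_conj, mul_assoc, ← norm_mul]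
  have a1 := zb_half w hw
  have a2 : ‖w‖ ≤ 1 / 2 + |w.im| := by
    refine (Complex.norm_le_abs_re_add_abs_im w).trans ?_
    rw [hw]; norm_num
  have : (w + 1).im = w.im := by simp
  rw [this, mul_comm]
  exact mul_le_mul a1 a2 (norm_nonneg _) (by norm_num)

lemma zb_T (t u : ℝ) : |u| + 4 ≤ (|t| + 4) * (1 + |u - t|) := by
  have : |u| ≤ |t| + |u - t| := by
    have := abs_add_le t (u - t); simpa using this
  nlinarith [abs_nonneg t, abs_nonneg (u - t)]

lemma zb_gammacos : ∃ K : ℝ, 0 ≤ K ∧ ∀ z : ℂ, 1 / 2 ≤ z.re → z.re ≤ 3 / 2 →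
    ‖Complex.Gamma z * Complex.cos (π * z / 2)‖ ≤ K * (|z.im| + 4) ^ (z.re - 1 / 2) := by
  obtain ⟨B, hB⟩ := zb_Gamma_bdd (a := 1 / 2) (b := 3 / 2) (by norm_num) (by norm_num)
  have hB0 : 0 ≤ B := (norm_nonneg _).trans (hB 1 (by norm_num) (by norm_num))
  refine ⟨4 * Real.exp 3, by positivity, fun s hs1 hs2 => ?_⟩
  set T : ℝ := |s.im| + 4 with hT
  have hT4 : 4 ≤ T := by linarith [abs_nonneg s.im]
  have hT0 : 0 < T := by linarith
  have hTc : (T : ℂ) ≠ 0 := by exact_mod_cast hT0.ne'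
  have hnT : ∀ z : ℂ, ‖(T : ℂ) ^ (1 / 2 - z)‖ = T ^ (1 / 2 - z.re) := by
    intro z
    rw [Complex.norm_cpow_eq_rpow_re_of_pos hT0]; simp
  let g : ℂ → ℂ := fun z => Complex.Gamma z * Complex.cos (π * z / 2) *
    Complex.exp ((z - s.im * I) ^ 2) * (T : ℂ) ^ (1 / 2 - z)
  have hgn : ∀ z, ‖g z‖ = ‖Complex.Gamma z * Complex.cos (π * z / 2)‖ *
      ‖Complex.exp ((z - s.im * I) ^ 2)‖ * T ^ (1 / 2 - z.re) := by
    intro z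
    simp only [g]
    rw [norm_mul, norm_mul, hnT]
  have key : ‖g s‖ ≤ 4 * Real.exp 3 := by
    refine zb_PL (a := 1 / 2) (b := 3 / 2) (K := B * (2 * Real.exp 3)) (A := 2) (by norm_num) (by norm_num)
      (by norm_num) ?_ ?_ ?_ ?_ hs1 hs2
    · intro z hz
      have hz : 1 / 2 ≤ z.re := hz
      have hG : DifferentiableAt ℂ Complex.Gamma z := by
        refine Complex.differentiableAt_Gamma _ ?_
        rintro m rfl
        simp at hz
        have : (0:ℝ) ≤ m := Nat.cast_nonneg m
        linarith
      refine DifferentiableAt.differentiableWithinAt ?_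
      refine ((hG.mul (by fun_prop)).mul (by fun_prop)).mul ?_
      exact DifferentiableAt.const_cpow (by fun_prop) (Or.inl hTc)
    · intro z h1 h2 h3
      rw [hgn, norm_mul]
      have p1 := hB z h1.le h2.le
      have p2 : ‖Complex.cos (π * z / 2)‖ ≤ Real.exp (2 * |z.im|) := by
        refine (zb_cos_le _).trans (Real.exp_le_exp.2 ?_)
        have : (π * z / 2 : ℂ).im = π / 2 * z.im := by
          simp; ring
        rw [this, abs_mul, abs_of_pos (by positivity)]
        exact mul_le_mul_of_nonneg_right (by linarith [Real.pi_lt_four]) (abs_nonneg _)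
      have p3 := zb_gauss' z s.im (by linarith) (by linarith)
      have p4 : T ^ (1 / 2 - z.re) ≤ 1 :=
        Real.rpow_le_one_of_one_le_of_nonpos (by linarith) (by linarith)
      calc _ ≤ B * Real.exp (2 * |z.im|) * (2 * Real.exp 3) * 1 := by gcongr
        _ = _ := by ring
    · intro z hz
      rw [hgn, hz, sub_self, Real.rpow_zero, mul_one]
      calc _ ≤ 2 * (2 * Real.exp 3) :=
            mul_le_mul (zb_half z hz) (zb_gauss' z s.im (by linarith) (by linarith)) (norm_nonneg _)
              (by norm_num)
        _ = _ := by ring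
    · intro z hz
      rw [hgn, hz]
      have e : T ^ ((1:ℝ) / 2 - 3 / 2) = T⁻¹ := by
        rw [show ((1:ℝ) / 2 - 3 / 2) = -1 by norm_num, Real.rpow_neg_one]
      rw [e, ← div_eq_mul_inv, div_le_iff₀ hT0]
      have a1 := zb_threehalf z hz
      have a2 := zb_T s.im z.im
      have a3 := zb_gauss z s.im (by linarith) (by linarith)
      rw [← hT] at a2
      calc _ ≤ (2 * (T * (1 + |z.im - s.im|))) * ‖Complex.exp ((z - s.im * I) ^ 2)‖ := by
            refine mul_le_mul_of_nonneg_right ?_ (norm_nonneg _)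
            linarith
        _ = 2 * T * (‖Complex.exp ((z - s.im * I) ^ 2)‖ * (1 + |z.im - s.im|)) := by ring
        _ ≤ 2 * T * (2 * Real.exp 3) := by gcongr
        _ = _ := by ring
  rw [hgn] at key
  have k2 : ‖Complex.Gamma s * Complex.cos (π * s / 2)‖ * T ^ (1 / 2 - s.re) ≤ 4 * Real.exp 3 := by
    refine le_trans ?_ key
    refine mul_le_mul_of_nonneg_right ?_ (by positivity)
    exact le_mul_of_one_le_right (norm_nonneg _) (zb_gauss_ge s)
  rw [show s.re - 1 / 2 = -(1 / 2 - s.re) by ring, Real.rpow_neg hT0.le, ← div_eq_mul_inv,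
    le_div_iff₀ (by positivity)]
  exact k2

lemma zb_right : ∃ K : ℝ, 0 ≤ K ∧ ∀ z : ℂ, 1 < z.re → z.re ≤ 3 / 2 →
    ‖riemannZeta z‖ ≤ K / (z.re - 1) := by
  have hc : Continuous (fun x : ℝ => riemannZeta₀ (x : ℂ)) :=
    differentiable_riemannZeta₀.continuous.comp Complex.continuous_ofReal
  obtain ⟨M, hM⟩ := (isCompact_Icc (a := (1 : ℝ)) (b := 3 / 2)).exists_bound_of_continuousOn hc.continuousOn
  have hM0 : 0 ≤ M := (norm_nonneg _).trans (hM 1 (by constructor <;> norm_num))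
  refine ⟨1 + M, by positivity, fun z h1 h2 => ?_⟩
  have b1 : ‖riemannZeta z‖ ≤ ‖riemannZeta (z.re : ℂ)‖ := by
    rw [zeta_eq_tsum_one_div_nat_add_one_cpow h1,
      zeta_eq_tsum_one_div_nat_add_one_cpow (s := (z.re : ℂ)) (by simpa using h1)]
    have hn : ∀ n : ℕ, ‖1 / ((n : ℂ) + 1) ^ z‖ = 1 / ((n : ℝ) + 1) ^ z.re := by
      intro n
      have : ((n : ℂ) + 1) = ((n + 1 : ℝ) : ℂ) := by push_cast; ring
      rw [this, norm_div, norm_one, Complex.norm_cpow_eq_rpow_re_of_pos (by positivity)]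
    have hr : ∀ n : ℕ, 1 / ((n : ℂ) + 1) ^ (z.re : ℂ) = ((1 / ((n : ℝ) + 1) ^ z.re : ℝ) : ℂ) := by
      intro n
      rw [Complex.ofReal_div, Complex.ofReal_cpow (by positivity)]; push_cast; rfl
    simp_rw [hr]
    rw [← Complex.ofReal_tsum, Complex.norm_real]
    have hs : Summable (fun n : ℕ => 1 / ((n : ℝ) + 1) ^ z.re) := by
      have := (summable_nat_add_iff 1).2 (Real.summable_one_div_nat_rpow.2 h1)
      simpa using this
    refine (norm_tsum_le_tsum_norm (by simpa only [hn] using hs)).trans ?_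
    simp only [hn]
    exact le_abs_self _
  refine b1.trans ?_
  have hne : (z.re : ℂ) ≠ 1 := by
    intro h
    have : z.re = 1 := by exact_mod_cast h
    linarith
  have hp : 0 < z.re - 1 := by linarith
  rw [riemannZeta_eq_inv_sub_add hne]
  refine (norm_add_le _ _).trans ?_
  have c1 : ‖((z.re : ℂ) - 1)⁻¹‖ = (z.re - 1)⁻¹ := by
    rw [norm_inv, ← Complex.ofReal_one, ← Complex.ofReal_sub, Complex.norm_real, Real.norm_of_nonneg hp.le]
  have c2 := hM z.re ⟨h1.le, h2⟩
  rw [c1, le_div_iff₀ hp, add_mul, inv_mul_cancel₀ hp.ne']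
  have : ‖riemannZeta₀ (z.re : ℂ)‖ * (z.re - 1) ≤ M * 1 := mul_le_mul c2 (by linarith) hp.le hM0
  linarith

lemma zb_left : ∃ K : ℝ, 0 ≤ K ∧ ∀ z : ℂ, z.re < 0 → -(1 / 2) ≤ z.re →
    ‖riemannZeta z‖ ≤ K / (-z.re) * (|z.im| + 4) ^ (1 / 2 - z.re) := by
  obtain ⟨K1, h1, H1⟩ := zb_gammacos
  obtain ⟨K2, h2, H2⟩ := zb_right
  refine ⟨2 * K1 * K2, by positivity, fun z hz1 hz2 => ?_⟩
  obtain ⟨w, rfl⟩ : ∃ w, z = 1 - w := ⟨1 - z, by ring⟩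
  simp only [Complex.sub_re, Complex.one_re, Complex.sub_im, Complex.one_im, zero_sub, abs_neg] at *
  have a1 := H1 w (by linarith) (by linarith)
  have a2 := H2 w (by linarith) (by linarith)
  rw [riemannZeta_one_sub]
  · have a3 : ‖(2 * (π : ℂ)) ^ (-w)‖ ≤ 1 := by
      rw [show (2 * (π : ℂ)) = ((2 * π : ℝ) : ℂ) by push_cast; ring,
        Complex.norm_cpow_eq_rpow_re_of_pos (by positivity)]
      refine Real.rpow_le_one_of_one_le_of_nonpos (by linarith [Real.pi_gt_three]) ?_
      simp; linarith
    rw [mul_assoc (2 * _), norm_mul, norm_mul, norm_mul, Complex.norm_ofNat]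
    have hp : 0 < w.re - 1 := by linarith
    calc _ ≤ 2 * 1 * (K1 * (|w.im| + 4) ^ (w.re - 1 / 2)) * (K2 / (w.re - 1)) := by gcongr
      _ = _ := by
        rw [show (1:ℝ) / 2 - (1 - w.re) = w.re - 1 / 2 by ring, show -(1 - w.re) = w.re - 1 by ring]
        ring
  · rintro n rfl
    simp at hz1
    have : (0:ℝ) ≤ n := Nat.cast_nonneg n
    linarith
  · rintro rfl
    simp at hz1

lemma zb_D (z : ℂ) (h1 : z ≠ 1) (h2 : -(1 / 2) ≤ z.re) :
    ‖riemannZeta₁ z / (z + 2)‖ ≤ 4 * ‖riemannZeta z‖ := by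
  have hz1 : z - 1 ≠ 0 := sub_ne_zero.2 h1
  have e : riemannZeta₁ z = (z - 1) * riemannZeta z := by
    rw [riemannZeta_eq_inv_sub_mul h1, mul_inv_cancel_left₀ hz1]
  have n1 : 1 ≤ ‖z + 2‖ := by
    have := Complex.abs_re_le_norm (z + 2)
    have h3 := le_abs_self (z + 2).re
    simp at this h3
    linarith
  have n2 : ‖z - 1‖ ≤ 4 * ‖z + 2‖ := by
    have := norm_sub_le (z + 2) 3
    rw [show z + 2 - 3 = z - 1 by ring, Complex.norm_ofNat] at this
    linarith
  rw [e, norm_div, norm_mul, div_le_iff₀ (by linarith)]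
  nlinarith [norm_nonneg (riemannZeta z)]

lemma zb_high : ∃ K : ℝ, 0 ≤ K ∧ ∀ s : ℂ, 4 ≤ |s.im| → |s.re| ≤ 1 / Real.log (|s.im| + 4) →
    ‖riemannZeta s‖ ≤ K * (|s.im| + 4) ^ ((1:ℝ) / 2) * Real.log (|s.im| + 4) := by
  obtain ⟨K0, hK0, H0⟩ := zb_zeta_growth
  obtain ⟨K1, hK1, H1⟩ := zb_left
  obtain ⟨K2, hK2, H2⟩ := zb_right
  refine ⟨2 * (24 * Real.exp 3 * (K1 + K2)) * 3, by positivity, fun s hs4 hs => ?_⟩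
  set T : ℝ := |s.im| + 4 with hT
  have hT8 : 8 ≤ T := by linarith
  have hT1 : 1 ≤ T := by linarith
  have hT0 : 0 < T := by linarith
  have hTc : (T : ℂ) ≠ 0 := by exact_mod_cast hT0.ne'
  have hL : 2 ≤ Real.log T := by
    have h8 : Real.log 8 = 3 * Real.log 2 := by
      rw [show (8:ℝ) = 2 ^ 3 by norm_num, Real.log_pow]; norm_num
    have := Real.log_le_log (by norm_num) hT8
    linarith [Real.log_two_gt_d9]
  set δ : ℝ := 1 / Real.log T with hδ
  have hδ0 : 0 < δ := by positivity
  have hδ2 : δ ≤ 1 / 2 := one_div_le_one_div_of_le (by norm_num) hL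
  have hTδ : T ^ δ ≤ 3 := by
    have : T ^ δ = Real.exp 1 := by
      rw [Real.rpow_def_of_pos hT0, hδ, mul_one_div_cancel (by linarith)]
    rw [this]
    linarith [Real.exp_one_lt_d9]
  have hTδ2 : T ^ (δ / 2) ≤ 3 :=
    (Real.rpow_le_rpow_of_exponent_le hT1 (by linarith)).trans hTδ
  have hnT : ∀ z : ℂ, ‖(T : ℂ) ^ ((z - 1) / 2)‖ = T ^ ((z.re - 1) / 2) := by
    intro z
    rw [Complex.norm_cpow_eq_rpow_re_of_pos hT0]; simp
  let g : ℂ → ℂ := fun z => riemannZeta₁ z / (z + 2) *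
    Complex.exp ((z - s.im * I) ^ 2) * (T : ℂ) ^ ((z - 1) / 2)
  have hgn : ∀ z, ‖g z‖ = ‖riemannZeta₁ z / (z + 2)‖ *
      ‖Complex.exp ((z - s.im * I) ^ 2)‖ * T ^ ((z.re - 1) / 2) := by
    intro z
    simp only [g]
    rw [norm_mul, norm_mul, hnT]
  have hsr := abs_le.1 hs
  have hC : ∀ K, 0 ≤ K → K ≤ K1 + K2 →
      4 * (K / δ) * (2 * Real.exp 3) * 3 ≤ 24 * Real.exp 3 * (K1 + K2) / δ := by
    intro K _ h
    calc _ = 24 * Real.exp 3 * K / δ := by ring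
      _ ≤ _ := by gcongr
  have key : ‖g s‖ ≤ 24 * Real.exp 3 * (K1 + K2) / δ := by
    refine zb_PL (a := -δ) (b := 1 + δ) (K := 4 * K0 * (2 * Real.exp 3) * T) (A := 2) (by linarith)
      (by linarith) (by norm_num) ?_ ?_ ?_ ?_ (by linarith) (by linarith)
    · intro z hz
      have hz : -δ ≤ z.re := hz
      have hz2 : z + 2 ≠ 0 := by
        intro h
        have := congrArg Complex.re h
        simp at this
        linarith
      refine DifferentiableAt.differentiableWithinAt ?_
      have d1 : DifferentiableAt ℂ (fun z : ℂ => riemannZeta₁ z / (z + 2)) z :=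
        DifferentiableAt.fun_div differentiable_riemannZeta₁.differentiableAt (by fun_prop) hz2
      refine (d1.mul (by fun_prop)).mul ?_
      exact DifferentiableAt.const_cpow (by fun_prop) (Or.inl hTc)
    · intro z h1 h2 h3
      have hz1 : z ≠ 1 := by
        rintro rfl
        simp at h3
        linarith
      rw [hgn]
      have p1 := zb_D z hz1 (by linarith)
      have p2 := H0 z (by linarith) (by linarith) h3
      have p3 := zb_gauss' z s.im (by linarith) (by linarith)
      have p4 : T ^ ((z.re - 1) / 2) ≤ T := by
        nth_rewrite 2 [← Real.rpow_one T]
        exact Real.rpow_le_rpow_of_exponent_le hT1 (by linarith)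
      calc _ ≤ (4 * (K0 * Real.exp (2 * |z.im|))) * (2 * Real.exp 3) * T := by
            gcongr
            exact p1.trans (by linarith)
        _ = _ := by ring
    · intro z hz
      have hz1 : z ≠ 1 := by
        rintro rfl
        simp at hz
        linarith
      rw [hgn]
      have p1 := zb_D z hz1 (by linarith)
      have p2 := H1 z (by linarith) (by linarith)
      have p3 := zb_gauss z s.im (by linarith) (by linarith)
      have a2 := zb_T s.im z.im
      rw [← hT] at a2
      rw [hz] at p2 ⊢
      rw [neg_neg, sub_neg_eq_add] at p2
      set u := 1 + |z.im - s.im|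
      have hu : 1 ≤ u := by simp only [u]; linarith [abs_nonneg (z.im - s.im)]
      have p4 : (|z.im| + 4) ^ (1 / 2 + δ) ≤ T ^ (1 / 2 + δ) * u := by
        calc _ ≤ (T * u) ^ (1 / 2 + δ) :=
              Real.rpow_le_rpow (by positivity) a2 (by linarith)
          _ = T ^ (1 / 2 + δ) * u ^ (1 / 2 + δ) := Real.mul_rpow hT0.le (by linarith)
          _ ≤ T ^ (1 / 2 + δ) * u ^ (1 : ℝ) := by
              gcongr
              linarith
          _ = _ := by rw [Real.rpow_one]
      set E := ‖Complex.exp ((z - s.im * I) ^ 2)‖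
      have p5 : T ^ (1 / 2 + δ) * T ^ ((-δ - 1) / 2) ≤ 3 := by
        rw [← Real.rpow_add hT0]
        convert hTδ2 using 2
        ring
      calc _ ≤ (4 * (K1 / δ * (T ^ (1 / 2 + δ) * u))) * E * T ^ ((-δ - 1) / 2) := by
            gcongr
            refine p1.trans ?_
            refine mul_le_mul_of_nonneg_left (p2.trans ?_) (by norm_num)
            gcongr
        _ = 4 * (K1 / δ) * (E * u) * (T ^ (1 / 2 + δ) * T ^ ((-δ - 1) / 2)) := by ring
        _ ≤ 4 * (K1 / δ) * (2 * Real.exp 3) * 3 := by gcongr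
        _ ≤ _ := hC K1 hK1 (by linarith)
    · intro z hz
      have hz1 : z ≠ 1 := by
        rintro rfl
        simp at hz
        linarith
      rw [hgn]
      have p1 := zb_D z hz1 (by linarith)
      have p2 := H2 z (by linarith) (by linarith)
      have p3 := zb_gauss' z s.im (by linarith) (by linarith)
      rw [hz] at p2 ⊢
      rw [add_sub_cancel_left] at p2 ⊢
      calc _ ≤ 4 * (K2 / δ) * (2 * Real.exp 3) * 3 := by
            gcongr
            exact p1.trans (by linarith)
        _ ≤ _ := hC K2 hK2 (by linarith)
  rw [hgn] at key
  have hs1 : s ≠ 1 := by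
    rintro rfl
    simp at hs4
    linarith
  have hd : ‖riemannZeta s‖ ≤ 2 * ‖riemannZeta₁ s / (s + 2)‖ := by
    have n0 : 4 ≤ ‖s - 1‖ := by
      have := Complex.abs_im_le_norm (s - 1)
      simp at this
      linarith
    have n1 : 0 < ‖s + 2‖ := by
      have := Complex.abs_im_le_norm (s + 2)
      simp at this
      linarith
    have n2 : ‖s + 2‖ ≤ 2 * ‖s - 1‖ := by
      have := norm_add_le (s - 1) 3
      rw [show s - 1 + 3 = s + 2 by ring, Complex.norm_ofNat] at this
      linarith
    rw [riemannZeta_eq_inv_sub_mul hs1, norm_mul, norm_inv, norm_div, inv_mul_eq_div, ← mul_div_assoc,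
      div_le_div_iff₀ (by linarith) n1]
    nlinarith [norm_nonneg (riemannZeta₁ s)]
  have k2 : ‖riemannZeta₁ s / (s + 2)‖ * T ^ ((s.re - 1) / 2) ≤ 24 * Real.exp 3 * (K1 + K2) / δ := by
    refine le_trans ?_ key
    refine mul_le_mul_of_nonneg_right ?_ (by positivity)
    exact le_mul_of_one_le_right (norm_nonneg _) (zb_gauss_ge s)
  have hTT : 1 ≤ T ^ ((s.re - 1) / 2) * (3 * T ^ ((1:ℝ) / 2)) := by
    calc (1:ℝ) ≤ T ^ ((s.re - 1) / 2) * (T ^ δ * T ^ ((1:ℝ) / 2)) := by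
          rw [← Real.rpow_add hT0, ← Real.rpow_add hT0]
          exact Real.one_le_rpow hT1 (by linarith)
      _ ≤ _ := by gcongr
  have hδi : 24 * Real.exp 3 * (K1 + K2) / δ = 24 * Real.exp 3 * (K1 + K2) * Real.log T := by
    rw [hδ]; field_simp
  rw [hδi] at k2
  calc ‖riemannZeta s‖ ≤ 2 * ‖riemannZeta₁ s / (s + 2)‖ := hd
    _ ≤ 2 * ‖riemannZeta₁ s / (s + 2)‖ * (T ^ ((s.re - 1) / 2) * (3 * T ^ ((1:ℝ) / 2))) :=
        le_mul_of_one_le_right (by positivity) hTT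
    _ = 2 * (‖riemannZeta₁ s / (s + 2)‖ * T ^ ((s.re - 1) / 2)) * (3 * T ^ ((1:ℝ) / 2)) := by ring
    _ ≤ 2 * (24 * Real.exp 3 * (K1 + K2) * Real.log T) * (3 * T ^ ((1:ℝ) / 2)) := by gcongr
    _ = _ := by ring

lemma zb_low : ∃ B : ℝ, 0 ≤ B ∧ ∀ s : ℂ, |s.im| ≤ 4 → |s.re| ≤ 1 / Real.log (|s.im| + 4) →
    ‖riemannZeta s‖ ≤ B := by
  have hl4 : 1 < Real.log 4 := by
    rw [show (4:ℝ) = 2 ^ 2 by norm_num, Real.log_pow]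
    push_cast
    linarith [Real.log_two_gt_d9]
  set r := 1 / Real.log 4 with hr
  have hr1 : r < 1 := by rw [hr, div_lt_one (by linarith)]; exact hl4
  have hr0 : 0 ≤ r := by positivity
  have hcomp : IsCompact (Set.Icc (-r) r ×ℂ Set.Icc (-4 : ℝ) 4) := isCompact_Icc.reProdIm isCompact_Icc
  obtain ⟨B, hB⟩ := hcomp.exists_bound_of_continuousOn (f := riemannZeta) (by
    intro z hz
    refine (differentiableAt_riemannZeta ?_).continuousAt.continuousWithinAt
    rintro rfl
    have := hz.1.2
    simp at this
    linarith)
  have hB0 : 0 ≤ B := (norm_nonneg _).trans (hB 0 (by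
    constructor
    · simp [hr0]
    · simp))
  refine ⟨B, hB0, fun s h1 h2 => hB s ?_⟩
  have : |s.re| ≤ r := h2.trans (one_div_le_one_div_of_le (by linarith)
    (Real.log_le_log (by norm_num) (by linarith [abs_nonneg s.im])))
  exact ⟨abs_le.1 this, abs_le.1 h1⟩

theorem zeta_bound_near_critical_strip :
    ∃ C : ℝ, 0 < C ∧
      ∀ s : ℂ, |s.re| ≤ 1 / Real.log (|s.im| + 4) →
        ‖riemannZeta s‖ ≤ C * (|s.im| + 2) ^ ((1:ℝ) / 2) * Real.log (|s.im| + 2) := by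
  obtain ⟨K, hK, HK⟩ := zb_high
  obtain ⟨B, hB, HB⟩ := zb_low
  refine ⟨4 * K + 2 * B + 1, by positivity, fun s hs => ?_⟩
  have hx : 0 ≤ |s.im| := abs_nonneg _
  set x := |s.im|
  have hlog : 1 / 2 ≤ Real.log (x + 2) := by
    have := Real.log_le_log (show (0:ℝ) < 2 by norm_num) (show 2 ≤ x + 2 by linarith)
    linarith [Real.log_two_gt_d9]
  have hpow : 1 ≤ (x + 2) ^ ((1:ℝ) / 2) := Real.one_le_rpow (by linarith) (by norm_num)
  rcases le_total x 4 with h | h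
  · have := HB s h hs
    calc _ ≤ B := this
      _ ≤ (4 * K + 2 * B + 1) * 1 * (1 / 2) := by linarith
      _ ≤ _ := by gcongr
  · have := HK s h hs
    have l1 : Real.log (x + 4) ≤ 2 * Real.log (x + 2) := by
      have : Real.log ((x + 2) ^ 2) = 2 * Real.log (x + 2) := by rw [Real.log_pow]; norm_num
      rw [← this]
      exact Real.log_le_log (by linarith) (by nlinarith)
    have l0 : 0 ≤ Real.log (x + 4) := Real.log_nonneg (by linarith)
    have l2 : (x + 4) ^ ((1:ℝ) / 2) ≤ 2 * (x + 2) ^ ((1:ℝ) / 2) := by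
      have h4 : (4:ℝ) ^ ((1:ℝ) / 2) = 2 := by
        rw [show (4:ℝ) = 2 ^ (2:ℝ) by norm_num, ← Real.rpow_mul (by norm_num)]; norm_num
      calc (x + 4) ^ ((1:ℝ) / 2) ≤ (4 * (x + 2)) ^ ((1:ℝ) / 2) :=
            Real.rpow_le_rpow (by linarith) (by linarith) (by norm_num)
        _ = _ := by rw [Real.mul_rpow (by norm_num) (by linarith), h4]
    calc _ ≤ K * (x + 4) ^ ((1:ℝ) / 2) * Real.log (x + 4) := this
      _ ≤ K * (2 * (x + 2) ^ ((1:ℝ) / 2)) * (2 * Real.log (x + 2)) := by gcongr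
      _ = (4 * K) * (x + 2) ^ ((1:ℝ) / 2) * Real.log (x + 2) := by ring
      _ ≤ _ := by gcongr; linarith
end

section
/- There exists an absolute constant C > 0 such that the following holds. Let a, b ∈ ℂ with |Re a| ≤ 1/4 and |Re b| ≤ 1/4, set c = a − b, and let t ∈ ℝ satisfy |t + Im a| > 10|c| and |t + Im b| > 10|c|. Then | R(1/2 − a − it) − R(1/2 − b − it) | ≤ C ( |c|² + |c| · |t + Im a| ) / ( |t + Im a|² · (|t + Im a| + 1) ). -/
open Complex Real

/-- The Stirling remainder `R(s) = ∫₀^∞ g(x)/(x+s)² dx` with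
`g(x) = {x}({x}-1)/2`, so that
`log Γ(s) = (s - 1/2) Log s - s + (1/2) log(2π) + R(s)` for `Re s > 0`. -/
noncomputable def stirlingR (s : ℂ) : ℂ :=
  ∫ x in Set.Ioi (0 : ℝ),
    ((Int.fract x * (Int.fract x - 1) / 2 : ℝ) : ℂ) / ((x : ℂ) + s) ^ 2

open MeasureTheory in
lemma aux_int3 (m : ℝ) (hm : 0 < m) :
    IntegrableOn (fun x : ℝ => 1 / (x + m) ^ 3) (Set.Ioi 0) ∧
      ∫ x in Set.Ioi (0 : ℝ), 1 / (x + m) ^ 3 = 1 / (2 * m ^ 2) := by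
  have hd : ∀ x ∈ Set.Ici (0 : ℝ),
      HasDerivAt (fun x : ℝ => -(1 / 2) * ((x + m) ^ 2)⁻¹) (1 / (x + m) ^ 3) x := by
    intro x hx
    have hx' : (0 : ℝ) ≤ x := hx
    have h0 : x + m ≠ 0 := by positivity
    have h1 := ((((hasDerivAt_id x).add_const m).pow 2).inv (pow_ne_zero 2 h0)).const_mul (-(1 / 2) : ℝ)
    refine h1.congr_deriv ?_
    simp
    field_simp
  have ht : Filter.Tendsto (fun x : ℝ => -(1 / 2) * ((x + m) ^ 2)⁻¹) Filter.atTop (nhds 0) := by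
    have h1 : Filter.Tendsto (fun x : ℝ => (x + m) ^ 2) Filter.atTop Filter.atTop :=
      (Filter.tendsto_pow_atTop two_ne_zero).comp
        (Filter.tendsto_atTop_add_const_right _ m Filter.tendsto_id)
    simpa using (h1.inv_tendsto_atTop).const_mul (-(1 / 2) : ℝ)
  have hi : IntegrableOn (fun x : ℝ => 1 / (x + m) ^ 3) (Set.Ioi 0) := by
    refine integrableOn_Ioi_deriv_of_nonneg' hd ?_ ht
    intro x hx
    have hx' : (0 : ℝ) < x := hx
    positivity
  refine ⟨hi, ?_⟩
  rw [integral_Ioi_of_hasDerivAt_of_tendsto' hd hi ht]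
  simp
  field_simp

open MeasureTheory in
lemma aux_int2 (m : ℝ) (hm : 0 < m) :
    IntegrableOn (fun x : ℝ => 1 / (x + m) ^ 2) (Set.Ioi 0) := by
  have h := integrableOn_add_rpow_Ioi_of_lt (a := -2) (c := 0) (m := m) (by norm_num) (by linarith)
  refine h.congr_fun ?_ measurableSet_Ioi
  intro x hx
  have hx' : (0 : ℝ) < x := hx
  simp only
  rw [Real.rpow_neg (by positivity)]
  norm_num

lemma aux_g (x : ℝ) :
    ‖((Int.fract x * (Int.fract x - 1) / 2 : ℝ) : ℂ)‖ ≤ 1 / 8 := by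
  rw [Complex.norm_real, Real.norm_eq_abs, abs_le]
  have h0 := Int.fract_nonneg x
  have h1 := Int.fract_lt_one x
  constructor <;> nlinarith [sq_nonneg (Int.fract x - 1 / 2)]

lemma aux_low (s : ℂ) (hs : 1 / 4 ≤ s.re) (x : ℝ) (hx : 0 < x) :
    (x + 1 / 4 + |s.im|) / 2 ≤ ‖(x : ℂ) + s‖ := by
  have h1 := Complex.abs_re_le_norm ((x : ℂ) + s)
  have h2 := Complex.abs_im_le_norm ((x : ℂ) + s)
  simp at h1 h2
  have := le_abs_self (x + s.re)
  linarith

open MeasureTheory in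
lemma aux_integrable (s : ℂ) (hs : 1 / 4 ≤ s.re) :
    Integrable (fun x : ℝ => ((Int.fract x * (Int.fract x - 1) / 2 : ℝ) : ℂ) / ((x : ℂ) + s) ^ 2)
      (volume.restrict (Set.Ioi 0)) := by
  refine Integrable.mono' (aux_int2 (1 / 4) (by norm_num)) ?_ ?_
  · apply Measurable.aestronglyMeasurable
    fun_prop
  · refine (ae_restrict_iff' measurableSet_Ioi).2 (Filter.Eventually.of_forall ?_)
    intro x hx
    have hx' : (0 : ℝ) < x := hx
    have h1 := aux_low s hs x hx'
    have h2 := aux_g x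
    have h3 : (x + 1 / 4) / 2 ≤ ‖(x : ℂ) + s‖ := by linarith [abs_nonneg s.im]
    rw [norm_div, norm_pow]
    calc _ ≤ (1 / 8) / ((x + 1 / 4) / 2) ^ 2 := by gcongr
      _ = (1 / 2) * (1 / (x + 1 / 4) ^ 2) := by field_simp; norm_num
      _ ≤ 1 / (x + 1 / 4) ^ 2 := by
        have : 0 ≤ 1 / (x + 1 / 4) ^ 2 := by positivity
        linarith

lemma aux_diff (g u v : ℂ) (w : ℝ) (hw : 0 < w) (hg : ‖g‖ ≤ 1 / 8) (hu : w / 4 ≤ ‖u‖)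
    (hv : w / 4 ≤ ‖v‖) : ‖g / u ^ 2 - g / v ^ 2‖ ≤ 16 * ‖u - v‖ * (1 / w ^ 3) := by
  have hu0 : u ≠ 0 := norm_pos_iff.1 (by linarith)
  have hv0 : v ≠ 0 := norm_pos_iff.1 (by linarith)
  have e : g / u ^ 2 - g / v ^ 2 = g * (v - u) * (1 / (u * v ^ 2) + 1 / (u ^ 2 * v)) := by
    field_simp
    ring
  rw [e, norm_mul, norm_mul, norm_sub_rev v u]
  have h1 : ‖1 / (u * v ^ 2) + 1 / (u ^ 2 * v)‖ ≤
      1 / ((w / 4) * (w / 4) ^ 2) + 1 / ((w / 4) ^ 2 * (w / 4)) := by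
    refine (norm_add_le _ _).trans ?_
    simp only [norm_div, norm_mul, norm_pow, norm_one]
    gcongr
  calc _ ≤ 1 / 8 * ‖u - v‖ * (1 / ((w / 4) * (w / 4) ^ 2) + 1 / ((w / 4) ^ 2 * (w / 4))) := by
        gcongr
    _ = _ := by field_simp; ring

theorem stirling_remainder_difference_bound :
    ∃ C : ℝ, 0 < C ∧
      ∀ a b : ℂ, |a.re| ≤ 1 / 4 → |b.re| ≤ 1 / 4 →
        ∀ t : ℝ, 10 * ‖a - b‖ < |t + a.im| → 10 * ‖a - b‖ < |t + b.im| →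
          ‖stirlingR (1 / 2 - a - t * I) - stirlingR (1 / 2 - b - t * I)‖ ≤
            C * (‖a - b‖ ^ 2 + ‖a - b‖ * |t + a.im|) /
              (|t + a.im| ^ 2 * (|t + a.im| + 1)) := by
  refine ⟨16, by norm_num, ?_⟩
  intro a b ha hb t hta htb
  rw [abs_le] at ha hb
  set T := |t + a.im| with hT
  have hc0 := norm_nonneg (a - b)
  have hT0 : 0 < T := by linarith
  have hre1 : 1 / 4 ≤ (1 / 2 - a - t * I : ℂ).re := by simp; linarith
  have hre2 : 1 / 4 ≤ (1 / 2 - b - t * I : ℂ).re := by simp; linarith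
  have him1 : |(1 / 2 - a - t * I : ℂ).im| = T := by
    rw [hT, ← abs_neg]; simp
  have him2 : T / 2 ≤ |(1 / 2 - b - t * I : ℂ).im| := by
    have e : |(1 / 2 - b - t * I : ℂ).im| = |t + b.im| := by
      rw [← abs_neg]; simp
    rw [e]
    have h1 := Complex.abs_im_le_norm (a - b)
    have h2 := abs_sub_abs_le_abs_sub (t + a.im) (t + b.im)
    have h3 : t + a.im - (t + b.im) = (a - b).im := by simp
    rw [h3] at h2
    linarith
  have hI := aux_int3 (1 / 4 + T) (by positivity)
  unfold stirlingR
  rw [← MeasureTheory.integral_sub (aux_integrable _ hre1) (aux_integrable _ hre2)]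
  have hb := MeasureTheory.norm_integral_le_of_norm_le (μ := MeasureTheory.volume.restrict (Set.Ioi 0))
    (f := fun x : ℝ =>
      ((Int.fract x * (Int.fract x - 1) / 2 : ℝ) : ℂ) / ((x : ℂ) + (1 / 2 - a - t * I)) ^ 2 -
      ((Int.fract x * (Int.fract x - 1) / 2 : ℝ) : ℂ) / ((x : ℂ) + (1 / 2 - b - t * I)) ^ 2)
    (hI.1.const_mul (16 * ‖a - b‖)) (by
      refine (MeasureTheory.ae_restrict_iff' measurableSet_Ioi).2 (Filter.Eventually.of_forall ?_)
      intro x hx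
      have hx' : (0 : ℝ) < x := hx
      have h1 := aux_low _ hre1 x hx'
      have h2 := aux_low _ hre2 x hx'
      rw [him1] at h1
      refine (aux_diff _ _ _ (x + (1 / 4 + T)) (by positivity) (aux_g x) (by linarith)
        (by linarith)).trans_eq ?_
      rw [← norm_neg (a - b)]
      congr 3
      congr 1
      ring)
  refine hb.trans ?_
  rw [MeasureTheory.integral_const_mul, hI.2]
  have k1 : 1 / (2 * (1 / 4 + T) ^ 2) ≤ 1 / (T * (T + 1)) := by
    apply one_div_le_one_div_of_le (by positivity)
    nlinarith
  calc _ ≤ 16 * ‖a - b‖ * (1 / (T * (T + 1))) := by gcongr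
    _ = 16 * (0 + ‖a - b‖ * T) / (T ^ 2 * (T + 1)) := by field_simp; ring
    _ ≤ _ := by gcongr; positivity
end
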